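/- Let X be a finite T₀ topological space. Then X is a unique path space if and only if for every x ∈ X the following holds: the sets closure {y}, for y ranging over the elements covered by x in the specialization order, are pairwise disjoint and their union equals closure {x} \ {x}. -/

import Mathlib

open Set Topology

variable {X : Type*} [TopologicalSpace X]

/-- Specialization order: `x ≤ y` iff `x ∈ closure {y}`. -/
def SpecLE (x y : X) : Prop := x ∈ closure ({y} : Set X)

/-- Strict specialization order. -/
def SpecLT (x y : X) : Prop := SpecLE x y ∧ ¬ SpecLE y x

/-- `CoversRel y x` means `y → x`: `x < y` and there is no `z` with `x < z < y`. -/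
def CoversRel (y x : X) : Prop := SpecLT x y ∧ ∀ z : X, ¬ (SpecLT x z ∧ SpecLT z y)

/-- `IsPathList y x l`: the list `l = [z₁, …, zₙ]` is a path from `y` to `x`, i.e.
`z₁ = x`, `zₙ = y` and `z_{k+1}` covers `z_k` for each `k`. -/
def IsPathList (y x : X) (l : List X) : Prop :=
  l ≠ [] ∧ l.head? = some x ∧ l.getLast? = some y ∧ l.Chain' (fun a b => CoversRel b a)

/-- `X` is a unique path space if for all `x, y` there is at most one path from `y` to `x`. -/
def UniquePathSpace (X : Type*) [TopologicalSpace X] : Prop :=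
  ∀ x y : X, ∀ l₁ l₂ : List X, IsPathList y x l₁ → IsPathList y x l₂ → l₁ = l₂

/-- The smallest open set containing a set `S` (in a finite space this is open). -/
def tildeSet (S : Set X) : Set X := ⋂₀ {U : Set X | IsOpen U ∧ S ⊆ U}

/-- The smallest open set containing the point `x`, denoted `õ{x}`. -/
def osi (x : X) : Set X := tildeSet {x}

/-- `S` is locally closed: `S = U \ V` for open sets `V ⊆ U`. -/
def LocClosed (S : Set X) : Prop :=
  ∃ U V : Set X, IsOpen U ∧ IsOpen V ∧ V ⊆ U ∧ S = U \ V

/-- `S` is relatively open in `T`. -/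
def RelOpen (S T : Set X) : Prop := ∃ O : Set X, IsOpen O ∧ S = O ∩ T

/-- `S` is relatively closed in `T`. -/
def RelClosed (S T : Set X) : Prop := ∃ Z : Set X, IsClosed Z ∧ S = Z ∩ T

/-- `(U, C)` is a boundary pair: `Y = U ∪ C` is locally closed, `U` is open in `Y`,
and `C = Y \ U`. -/
def BoundaryPair (U C : Set X) : Prop :=
  LocClosed (U ∪ C) ∧ RelOpen U (U ∪ C) ∧ C = (U ∪ C) \ U

/-- An elementary boundary pair. -/
def ElementaryBP (U C : Set X) : Prop :=
  BoundaryPair U C ∧ IsConnected U ∧ IsConnected C ∧ IsOpen U ∧ IsClosed C ∧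
    U ⊆ tildeSet C ∧ C ⊆ closure U

/-- In a partial order, if distinct lower covers of a common element never have a common lower
bound, then a chain of covers is determined by its endpoints. -/
theorem List.IsChain.eq_of_covBy {P : Type*} [PartialOrder P]
    (H : ∀ x y₁ y₂ z : P, y₁ ⋖ x → y₂ ⋖ x → z ≤ y₁ → z ≤ y₂ → y₁ = y₂) (x : P) :
    ∀ (l₁ l₂ : List P) (y : P), (x :: l₁).IsChain (· ⋖ ·) → (x :: l₂).IsChain (· ⋖ ·) →
      (x :: l₁).getLast? = some y → (x :: l₂).getLast? = some y → l₁ = l₂ := by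
  have last_lt {l : List P} {y : P} (h : (x :: (l ++ [y])).IsChain (· ⋖ ·)) :
      ∃ a, (x :: l).getLast? = some a ∧ x ≤ a ∧ a ⋖ y := by
    rw [← List.cons_append, List.isChain_append] at h
    obtain ⟨a, ha⟩ : ∃ a, (x :: l).getLast? = some a := by
      simp [List.getLast?_cons]
    refine ⟨a, ha, ?_, h.2.2 a ha y (by simp)⟩
    have hlt : (x :: l).IsChain (· ≤ ·) := h.1.imp fun _ _ hab => hab.le
    rw [List.isChain_iff_pairwise, List.pairwise_cons] at hlt
    rcases List.mem_cons.1 (List.mem_of_getLast? ha) with rfl | hm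
    · exact le_rfl
    · exact hlt.1 a hm
  intro l₁
  induction l₁ using List.reverseRecOn with
  | nil =>
    intro l₂ y _ h₂ e₁ e₂
    induction l₂ using List.reverseRecOn with
    | nil => rfl
    | append_singleton l b _ =>
      obtain ⟨a, -, hxa, hab⟩ := last_lt h₂
      obtain rfl : x = y := by simpa using e₁
      obtain rfl : b = x := by
        rwa [← List.cons_append, List.getLast?_concat, Option.some_inj] at e₂
      exact absurd hab.lt hxa.not_gt
  | append_singleton m b ih =>
    intro l₂ y h₁ h₂ e₁ e₂
    obtain ⟨a, ha, hxa, hab⟩ := last_lt h₁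
    obtain rfl : b = y := by
      rwa [← List.cons_append, List.getLast?_concat, Option.some_inj] at e₁
    induction l₂ using List.reverseRecOn with
    | nil =>
      obtain rfl : x = b := by simpa using e₂
      exact absurd hab.lt hxa.not_gt
    | append_singleton l c _ =>
      obtain ⟨a', ha', hxa', hab'⟩ := last_lt h₂
      obtain rfl : c = b := by
        rwa [← List.cons_append, List.getLast?_concat, Option.some_inj] at e₂
      obtain rfl := H _ _ _ x hab hab' hxa hxa'
      rw [← List.cons_append, List.isChain_append] at h₁ h₂
      rw [ih l a h₁.1 h₂.1 ha ha']

attribute [local instance] specializationOrder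

theorem specLE_iff_le {X : Type*} [TopologicalSpace X] [T0Space X] {x y : X} :
    SpecLE x y ↔ x ≤ y :=
  specializes_iff_mem_closure.symm

theorem specLT_iff_lt {X : Type*} [TopologicalSpace X] [T0Space X] {x y : X} :
    SpecLT x y ↔ x < y := by
  rw [SpecLT, specLE_iff_le, specLE_iff_le, lt_iff_le_not_ge]

theorem coversRel_iff_covBy {X : Type*} [TopologicalSpace X] [T0Space X] {x y : X} :
    CoversRel y x ↔ x ⋖ y := by
  simp only [CoversRel, specLT_iff_lt, CovBy, not_and]

theorem mem_closure_singleton_iff_le {X : Type*} [TopologicalSpace X] [T0Space X] {x y : X} :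
    x ∈ closure ({y} : Set X) ↔ x ≤ y :=
  specLE_iff_le

theorem isPathList_iff {X : Type*} [TopologicalSpace X] [T0Space X] {x y : X} {l : List X} :
    IsPathList y x l ↔
      ∃ m, l = x :: m ∧ (x :: m).getLast? = some y ∧ (x :: m).IsChain (· ⋖ ·) := by
  have h : (fun a b : X => CoversRel b a) = (· ⋖ ·) := by
    ext a b
    exact coversRel_iff_covBy
  unfold IsPathList
  rw [h]
  constructor
  · rintro ⟨-, hx, hy, hc⟩
    obtain ⟨m, rfl⟩ := List.head?_eq_some_iff.1 hx
    exact ⟨m, rfl, hy, hc⟩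
  · rintro ⟨m, rfl, hy, hc⟩
    exact ⟨by simp, by simp, hy, hc⟩

theorem exists_isPathList {X : Type*} [TopologicalSpace X] [Finite X] [T0Space X] {x y : X}
    (h : x ≤ y) : ∃ l, IsPathList y x l := by
  classical
  have := Fintype.ofFinite X
  let : LocallyFiniteOrder X := Fintype.toLocallyFiniteOrder
  obtain ⟨m, hm, hy⟩ :=
    List.exists_isChain_cons_of_relationReflTransGen (le_iff_reflTransGen_covBy.1 h)
  exact ⟨x :: m, isPathList_iff.2 ⟨m, rfl, by rw [List.getLast?_eq_some_getLast (List.cons_ne_nil x m), hy], hm⟩⟩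

theorem IsPathList.append_singleton {X : Type*} [TopologicalSpace X] [T0Space X] {x y z : X}
    {l : List X} (h : IsPathList y x l) (hyz : y ⋖ z) : IsPathList z x (l ++ [z]) := by
  obtain ⟨m, rfl, hy, hc⟩ := isPathList_iff.1 h
  refine isPathList_iff.2 ⟨m ++ [z], rfl, ?_, ?_⟩
  · rw [← List.cons_append, List.getLast?_concat]
  · rw [← List.cons_append, List.isChain_append]
    refine ⟨hc, .singleton z, fun a ha b hb => ?_⟩
    obtain rfl : y = a := by simpa [hy] using ha
    obtain rfl : z = b := by simpa using hb
    exact hyz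

theorem stmt_4 {X : Type*} [TopologicalSpace X] [Finite X] [T0Space X] :
    UniquePathSpace X ↔
      ∀ x : X,
        (∀ y₁ y₂ : X, CoversRel x y₁ → CoversRel x y₂ → y₁ ≠ y₂ →
          closure ({y₁} : Set X) ∩ closure ({y₂} : Set X) = ∅) ∧
        (⋃ y ∈ {y : X | CoversRel x y}, closure ({y} : Set X)) =
          closure ({x} : Set X) \ {x} := by
  constructor
  · intro H x
    constructor
    · intro y₁ y₂ h₁ h₂ hne
      rw [Set.eq_empty_iff_forall_notMem]
      rintro z ⟨hz₁, hz₂⟩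
      obtain ⟨l₁, hl₁⟩ := exists_isPathList (mem_closure_singleton_iff_le.1 hz₁)
      obtain ⟨l₂, hl₂⟩ := exists_isPathList (mem_closure_singleton_iff_le.1 hz₂)
      have e := H _ _ _ _ (hl₁.append_singleton (coversRel_iff_covBy.1 h₁))
        (hl₂.append_singleton (coversRel_iff_covBy.1 h₂))
      obtain rfl := List.append_cancel_right e
      exact hne (Option.some_injective _ (hl₁.2.2.1.symm.trans hl₂.2.2.1))
    · ext z
      simp only [Set.mem_iUnion, Set.mem_ofPred_eq, coversRel_iff_covBy,
        mem_closure_singleton_iff_le, Set.mem_sdiff, Set.mem_singleton_iff, exists_prop]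
      constructor
      · rintro ⟨y, hy, hz⟩
        exact ⟨hz.trans hy.le, (hz.trans_lt hy.lt).ne⟩
      · rintro ⟨hz, hne⟩
        obtain ⟨y, hzy, hy⟩ := exists_le_covBy_of_lt (lt_of_le_of_ne hz hne)
        exact ⟨y, hy, hzy⟩
  · intro H x y l₁ l₂ h₁ h₂
    obtain ⟨m₁, rfl, e₁, c₁⟩ := isPathList_iff.1 h₁
    obtain ⟨m₂, rfl, e₂, c₂⟩ := isPathList_iff.1 h₂
    rw [List.IsChain.eq_of_covBy (fun x y₁ y₂ z hy₁ hy₂ hz₁ hz₂ => ?_) x m₁ m₂ y c₁ c₂ e₁ e₂]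
    by_contra hne
    exact Set.eq_empty_iff_forall_notMem.1 ((H x).1 y₁ y₂ (coversRel_iff_covBy.2 hy₁)
      (coversRel_iff_covBy.2 hy₂) hne) z
      ⟨mem_closure_singleton_iff_le.2 hz₁, mem_closure_singleton_iff_le.2 hz₂⟩
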